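/- Suppose that for every integer i, every k ≥ 1, and every α₁, …, α_k ∈ C^i satisfying δα₁ = 0 and δα_{j+1} = h(α_j) for 1 ≤ j ≤ k−1, there exists α_{k+1} ∈ C^i with δα_{k+1} = h(α_k). Then for every integer i, multiplication by X is injective on H^i(C ⊗ K⟦X⟧, D); equivalently, H^i(C ⊗ K⟦X⟧, D) is a torsion-free (hence finite free) module over the power series ring K⟦X⟧. -/

import Mathlib

/-- The twisted differential `δ ⊗ id + h ⊗ (a·)` on `M ⊗_K A`. -/
noncomputable def twD (K : Type*) [CommRing K] {M N A : Type*}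
    [AddCommGroup M] [Module K M] [AddCommGroup N] [Module K N]
    [CommRing A] [Algebra K A]
    (δ h : M →ₗ[K] N) (a : A) :
    TensorProduct K M A →ₗ[K] TensorProduct K N A :=
  TensorProduct.map δ (LinearMap.id : A →ₗ[K] A)
    + TensorProduct.map h (LinearMap.mulLeft K a)

/-- The coefficient of `X ^ k`, as a map `M ⊗ K⟦X⟧ → M`. -/
noncomputable def tensorCoeff (K : Type*) [CommRing K] (M : Type*) [AddCommGroup M] [Module K M]
    (k : ℕ) : TensorProduct K M (PowerSeries K) →ₗ[K] M :=
  (TensorProduct.rid K M).toLinearMap ∘ₗ TensorProduct.map LinearMap.id (PowerSeries.coeff k)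

section tensorCoeff

variable {K : Type*} [CommRing K] {M N : Type*} [AddCommGroup M] [Module K M]
  [AddCommGroup N] [Module K N]

@[simp]
theorem tensorCoeff_tmul (k : ℕ) (m : M) (f : PowerSeries K) :
    tensorCoeff K M k (TensorProduct.tmul K m f) = PowerSeries.coeff k f • m := by
  simp [tensorCoeff]

theorem tensorCoeff_zero_map_X (f : M →ₗ[K] N) (t : TensorProduct K M (PowerSeries K)) :
    tensorCoeff K N 0
      (TensorProduct.map f (LinearMap.mulLeft K (PowerSeries.X : PowerSeries K)) t) = 0 := by
  induction t with
  | zero => simp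
  | tmul m p => simp
  | add x y hx hy => simp [hx, hy]

theorem tensorCoeff_succ_map_X (f : M →ₗ[K] N) (k : ℕ)
    (t : TensorProduct K M (PowerSeries K)) :
    tensorCoeff K N (k + 1)
      (TensorProduct.map f (LinearMap.mulLeft K (PowerSeries.X : PowerSeries K)) t) =
      f (tensorCoeff K M k t) := by
  induction t with
  | zero => simp
  | tmul m p => simp [PowerSeries.coeff_succ_X_mul]
  | add x y hx hy => simp [hx, hy]

theorem tensorCoeff_map_id (f : M →ₗ[K] N) (k : ℕ) (t : TensorProduct K M (PowerSeries K)) :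
    tensorCoeff K N k (TensorProduct.map f LinearMap.id t) = f (tensorCoeff K M k t) := by
  induction t with
  | zero => simp
  | tmul m p => simp
  | add x y hx hy => simp [hx, hy]

theorem tensorCoeff_zero_twD (δ h : M →ₗ[K] N) (t : TensorProduct K M (PowerSeries K)) :
    tensorCoeff K N 0 (twD K δ h PowerSeries.X t) = δ (tensorCoeff K M 0 t) := by
  simp [twD, tensorCoeff_map_id, tensorCoeff_zero_map_X]

theorem tensorCoeff_succ_twD (δ h : M →ₗ[K] N) (k : ℕ)
    (t : TensorProduct K M (PowerSeries K)) :
    tensorCoeff K N (k + 1) (twD K δ h PowerSeries.X t) =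
      δ (tensorCoeff K M (k + 1) t) + h (tensorCoeff K M k t) := by
  simp [twD, tensorCoeff_map_id, tensorCoeff_succ_map_X]

theorem tensorCoeff_ext [Module.Free K M] {s t : TensorProduct K M (PowerSeries K)}
    (hst : ∀ k, tensorCoeff K M k s = tensorCoeff K M k t) : s = t := by
  let b := Module.Free.chooseBasis K M
  rw [← sub_eq_zero]
  obtain ⟨c, hc⟩ := TensorProduct.eq_repr_basis_left b (s - t)
  suffices c = 0 by rw [← hc, this, Finsupp.sum_zero_index]
  have hzero (k : ℕ) : ∑ i ∈ c.support, PowerSeries.coeff k (c i) • b i = 0 := by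
    have := congrArg (tensorCoeff K M k) hc
    simpa [Finsupp.sum, hst k] using this
  ext i k
  by_cases hi : i ∈ c.support
  · simpa using linearIndependent_iff'.mp b.linearIndependent _ _ (hzero k) i hi
  · simp [Finsupp.notMem_support_iff.mp hi]

theorem exists_tensorCoeff_eq [Module.Free K M] [Module.Finite K M] (s : ℕ → M) :
    ∃ t, ∀ k, tensorCoeff K M k t = s k := by
  let b := Module.Free.chooseBasis K M
  refine ⟨∑ i, TensorProduct.tmul K (b i) (PowerSeries.mk fun k => b.repr (s k) i), fun k => ?_⟩
  simp [b.sum_repr]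

end tensorCoeff

/-- If every finite Massey chain extends, then every cocycle starts an infinite Massey chain. -/
theorem exists_massey_sequence {M N : Type*} [Zero N] (δ h : M → N)
    (hext : ∀ k : ℕ, 1 ≤ k → ∀ α : ℕ → M, δ (α 1) = 0 →
      (∀ j : ℕ, 1 ≤ j → j ≤ k - 1 → δ (α (j + 1)) = h (α j)) → ∃ β, δ β = h (α k))
    (x : M) (hx : δ x = 0) :
    ∃ u : ℕ → M, u 0 = x ∧ ∀ k, δ (u (k + 1)) = h (u k) := by
  let P (y : M) : Prop := ∃ k, 1 ≤ k ∧ ∃ α : ℕ → M, δ (α 1) = 0 ∧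
    (∀ j : ℕ, 1 ≤ j → j ≤ k - 1 → δ (α (j + 1)) = h (α j)) ∧ α k = y
  have step (y : Subtype P) : ∃ w : Subtype P, δ w = h y := by
    obtain ⟨y, k, hk, α, h0, hα, rfl⟩ := y
    obtain ⟨β, hβ⟩ := hext k hk α h0 hα
    refine ⟨⟨β, k + 1, by omega, Function.update α (k + 1) β, ?_, fun j hj hjk => ?_, by simp⟩, hβ⟩
    · rwa [Function.update_of_ne (by omega)]
    · rw [Function.update_of_ne (a := j) (by omega)]
      rcases eq_or_ne j k with rfl | hne
      · simpa using hβ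
      · rw [Function.update_of_ne (by omega)]
        exact hα j hj (by omega)
  choose f hf using step
  let x₀ : Subtype P := ⟨x, 1, le_rfl, fun _ => x, hx, fun j _ _ => by omega, rfl⟩
  refine ⟨fun k => (f^[k] x₀ : Subtype P), rfl, fun k => ?_⟩
  simp only [Function.iterate_succ_apply', hf]

/-- if every Massey chain associated to `h` extends (for every degree `i`,
every `k ≥ 1` and every chain `α 1, …, α k` with `δ(α 1) = 0` and `δ(α (j+1)) = h(α j)` for
`1 ≤ j ≤ k−1`, there is `β` with `δβ = h(α k)`), then multiplication by `X` is injective on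
each cohomology module `H^i(C ⊗ K⟦X⟧, D)`: a cocycle `z` whose multiple `X·z` is a
coboundary is itself a coboundary. -/
theorem torsion_free_of_massey_chains_extend
    (K : Type*) [Field K]
    (C : ℤ → Type*) [∀ i, AddCommGroup (C i)] [∀ i, Module K (C i)]
    [∀ i, FiniteDimensional K (C i)]
    (δ h : ∀ i : ℤ, C i →ₗ[K] C (i + 1))
    (hδδ : ∀ i : ℤ, (δ (i + 1)).comp (δ i) = 0)
    (hhh : ∀ i : ℤ, (h (i + 1)).comp (h i) = 0)
    (hanti : ∀ i : ℤ, (δ (i + 1)).comp (h i) + (h (i + 1)).comp (δ i) = 0)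
    (hext : ∀ (i : ℤ) (k : ℕ), 1 ≤ k → ∀ α : ℕ → C i,
      δ i (α 1) = 0 →
      (∀ j : ℕ, 1 ≤ j → j ≤ k - 1 → δ i (α (j + 1)) = h i (α j)) →
      ∃ β : C i, δ i β = h i (α k)) :
    ∀ (n : ℤ) (z : TensorProduct K (C (n + 1)) (PowerSeries K)),
      twD K (δ (n + 1)) (h (n + 1)) (PowerSeries.X : PowerSeries K) z = 0 →
      (TensorProduct.map (LinearMap.id : C (n + 1) →ₗ[K] C (n + 1))
          (LinearMap.mulLeft K (PowerSeries.X : PowerSeries K))) z ∈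
        LinearMap.range (twD K (δ n) (h n) (PowerSeries.X : PowerSeries K)) →
      z ∈ LinearMap.range (twD K (δ n) (h n) (PowerSeries.X : PowerSeries K)) := by
  rintro n z - ⟨y, hy⟩
  have hy_zero : δ n (tensorCoeff K _ 0 y) = 0 := by
    rw [← tensorCoeff_zero_twD (δ n) (h n), hy, tensorCoeff_zero_map_X]
  have hy_succ (k : ℕ) : δ n (tensorCoeff K _ (k + 1) y) + h n (tensorCoeff K _ k y) =
      tensorCoeff K _ k z := by
    rw [← tensorCoeff_succ_twD, hy, tensorCoeff_succ_map_X, LinearMap.id_apply]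
  obtain ⟨u, hu_zero, hu⟩ := exists_massey_sequence (δ n) (h n) (hext n) _ hy_zero
  obtain ⟨w, hw⟩ := exists_tensorCoeff_eq (K := K) fun k =>
    tensorCoeff K _ (k + 1) y - (-1 : K) ^ (k + 1) • u (k + 1)
  refine ⟨w, tensorCoeff_ext fun k => ?_⟩
  cases k with
  | zero =>
    rw [tensorCoeff_zero_twD, hw, ← hy_succ, map_sub, map_smul, hu, hu_zero]
    simp
  | succ k =>
    rw [tensorCoeff_succ_twD, hw, hw, ← hy_succ, map_sub, map_sub, map_smul, map_smul, hu,
      pow_succ _ (k + 1)]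
    module
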